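/- arXiv:2004.00976 — 3 statements merged into one kernel-verified Lean document; each statement's English description precedes it below -/
import Mathlib

section
/- Extended contraction principle for upper capacities: Let χ be a Polish space and (Υ, d) a metric space. For each ε ∈ (0,1] let 𝒫_ε be a nonempty set of Borel probability measures on χ and let c_ε be the associated upper capacity, c_ε(A) = sup_{P∈𝒫_ε} P(A). Assume that the family (c_ε)_{ε>0} satisfies the LDP with speed ε and good rate function Λ : χ → [0,∞] and is exponentially tight. For each ε ∈ (0,1] let f_ε : χ → Υ be a continuous map, and let f : χ → Υ be a Borel measurable map such that for every compact set K ⊂ χ one has limsup_{ε→0} sup_{x∈K} d(f_ε(x), f(x)) = 0. Then the family of image capacities A ↦ c_ε(f_ε^{-1}(A)) on Υ satisfies the LDP with speed ε and with the good rate function Λ'(y) = inf{Λ(x) : x ∈ χ, f(x) = y} (with the convention inf ∅ = +∞). -/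
open Filter MeasureTheory Topology ENNReal
open scoped NNReal

lemma aux_log_add (b b' : ℝ) (hb : b < b') :
    ∀ᶠ ε : ℝ in 𝓝[>] (0 : ℝ), ∀ x y z : ℝ≥0∞, z ≤ x + y →
      (ε : EReal) * ENNReal.log x < b → (ε : EReal) * ENNReal.log y < b →
      (ε : EReal) * ENNReal.log z < b' := by
  have h1 : Tendsto (fun ε : ℝ => ε * Real.log 2) (𝓝[>] (0 : ℝ)) (𝓝 0) := by
    have : Tendsto (fun ε : ℝ => ε * Real.log 2) (𝓝 (0 : ℝ)) (𝓝 (0 * Real.log 2)) :=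
      (continuous_id.mul continuous_const).tendsto 0
    rw [zero_mul] at this
    exact this.mono_left nhdsWithin_le_nhds
  have h2 := h1.eventually (gt_mem_nhds (sub_pos.2 hb))
  filter_upwards [h2, self_mem_nhdsWithin] with ε h3 h4 x y z hz hx hy
  have hε : (0 : ℝ) < ε := h4
  have hε' : (0 : EReal) ≤ ε := by exact_mod_cast hε.le
  have hm : (ε : EReal) * ENNReal.log (max x y) < b := by
    rcases max_choice x y with h | h <;> rw [h] <;> assumption
  have hz2 : z ≤ ENNReal.ofReal 2 * max x y := by
    refine hz.trans ?_
    rw [show ENNReal.ofReal 2 = 2 by norm_num, two_mul]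
    exact add_le_add (le_max_left _ _) (le_max_right _ _)
  calc (ε : EReal) * ENNReal.log z
      ≤ (ε : EReal) * ENNReal.log (ENNReal.ofReal 2 * max x y) :=
        mul_le_mul_of_nonneg_left (ENNReal.log_le_log hz2) hε'
    _ = ((ε * Real.log 2 : ℝ) : EReal) + (ε : EReal) * ENNReal.log (max x y) := by
        rw [ENNReal.log_mul_add, ENNReal.log_ofReal_of_pos two_pos,
          EReal.left_distrib_of_nonneg_of_ne_top hε' (EReal.coe_ne_top _), EReal.coe_mul]
    _ < (((b' - b : ℝ)) : EReal) + (b : EReal) :=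
        EReal.add_lt_add (by exact_mod_cast h3) hm
    _ = b' := by rw [← EReal.coe_add]; simp

lemma aux_sup_union {χ : Type*} [MeasurableSpace χ] (S : Set (Measure χ)) {A B C : Set χ}
    (h : A ⊆ B ∪ C) : (⨆ P ∈ S, P A) ≤ (⨆ P ∈ S, P B) + ⨆ P ∈ S, P C := by
  refine iSup₂_le fun P hP => ?_
  exact ((measure_mono h).trans (measure_union_le B C)).trans
    (add_le_add (le_iSup₂ (f := fun (P : Measure χ) (_ : P ∈ S) => P B) P hP)
      (le_iSup₂ (f := fun (P : Measure χ) (_ : P ∈ S) => P C) P hP))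

/-- **Extended contraction principle for upper capacities.** For each `ε ∈ (0,1]`, let `𝔓 ε`
be a nonempty set of Borel probability measures on a Polish space `χ`, with associated upper
capacity `c_ε A = ⨆ P ∈ 𝔓 ε, P A`. If the capacities satisfy an LDP with speed `ε` and good
rate function `Λ` and are exponentially tight, and the continuous maps `fε ε` converge to the
measurable map `f` uniformly on compacts as `ε → 0⁺`, then the image capacities
`A ↦ c_ε (fε ε ⁻¹' A)` satisfy an LDP with speed `ε` and good rate function
`Λ' y = inf {Λ x : f x = y}`. -/
theorem extended_contraction_principle_upper_capacities
    {χ Υ : Type*} [MetricSpace χ] [CompleteSpace χ] [TopologicalSpace.SeparableSpace χ]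
    [MeasurableSpace χ] [BorelSpace χ]
    [MetricSpace Υ] [MeasurableSpace Υ] [BorelSpace Υ]
    (𝔓 : ℝ → Set (Measure χ))
    (hne : ∀ ε ∈ Set.Ioc (0 : ℝ) 1, (𝔓 ε).Nonempty)
    (hprob : ∀ ε ∈ Set.Ioc (0 : ℝ) 1, ∀ P ∈ 𝔓 ε, IsProbabilityMeasure P)
    (Λ : χ → ℝ≥0∞)
    (hΛlsc : LowerSemicontinuous Λ)
    (hΛgood : ∀ α : ℝ≥0, IsCompact {x : χ | Λ x ≤ α})
    (hupper : ∀ F : Set χ, IsClosed F →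
      Filter.limsup (fun ε : ℝ => (ε : EReal) * ENNReal.log (⨆ P ∈ 𝔓 ε, P F))
          (𝓝[>] (0 : ℝ)) ≤ -(⨅ x ∈ F, (Λ x : EReal)))
    (hlower : ∀ O : Set χ, IsOpen O →
      -(⨅ x ∈ O, (Λ x : EReal)) ≤
        Filter.liminf (fun ε : ℝ => (ε : EReal) * ENNReal.log (⨆ P ∈ 𝔓 ε, P O))
          (𝓝[>] (0 : ℝ)))
    (htight : ∀ M : ℝ, 0 < M → ∃ K : Set χ, IsCompact K ∧
      Filter.limsup (fun ε : ℝ => (ε : EReal) * ENNReal.log (⨆ P ∈ 𝔓 ε, P Kᶜ))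
          (𝓝[>] (0 : ℝ)) ≤ ((-M : ℝ) : EReal))
    (fε : ℝ → χ → Υ)
    (hfε : ∀ ε ∈ Set.Ioc (0 : ℝ) 1, Continuous (fε ε))
    (f : χ → Υ) (hf : Measurable f)
    (hconv : ∀ K : Set χ, IsCompact K →
      Filter.limsup (fun ε : ℝ => ⨆ x ∈ K, edist (fε ε x) (f x)) (𝓝[>] (0 : ℝ)) = 0) :
    LowerSemicontinuous (fun y : Υ => ⨅ x ∈ f ⁻¹' {y}, Λ x) ∧
    (∀ α : ℝ≥0, IsCompact {y : Υ | (⨅ x ∈ f ⁻¹' {y}, Λ x) ≤ α}) ∧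
    (∀ F : Set Υ, IsClosed F →
      Filter.limsup (fun ε : ℝ => (ε : EReal) * ENNReal.log (⨆ P ∈ 𝔓 ε, P (fε ε ⁻¹' F)))
          (𝓝[>] (0 : ℝ))
        ≤ -(⨅ y ∈ F, ((⨅ x ∈ f ⁻¹' {y}, Λ x : ℝ≥0∞) : EReal))) ∧
    (∀ O : Set Υ, IsOpen O →
      -(⨅ y ∈ O, ((⨅ x ∈ f ⁻¹' {y}, Λ x : ℝ≥0∞) : EReal)) ≤
        Filter.liminf (fun ε : ℝ => (ε : EReal) * ENNReal.log (⨆ P ∈ 𝔓 ε, P (fε ε ⁻¹' O)))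
          (𝓝[>] (0 : ℝ))) := by
  have hunif : ∀ K : Set χ, IsCompact K → ∀ δ : ℝ≥0∞, 0 < δ →
      ∀ᶠ ε in 𝓝[>] (0 : ℝ), ∀ x ∈ K, edist (fε ε x) (f x) < δ := by
    intro K hK δ hδ
    have h := eventually_lt_of_limsup_lt (lt_of_eq_of_lt (hconv K hK) hδ)
    filter_upwards [h] with ε hε x hx
    exact lt_of_le_of_lt (le_iSup₂ (f := fun x (_ : x ∈ K) => edist (fε ε x) (f x)) x hx) hε
  have hev : ∀ᶠ ε in 𝓝[>] (0 : ℝ), ε ∈ Set.Ioc (0 : ℝ) 1 := Ioc_mem_nhdsGT one_pos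
  have hfc : Continuous f := by
    refine (CompactlyCoherentSpace.isCoherentWith (X := χ)).continuous_iff.2 fun K hK => ?_
    refine TendstoUniformlyOn.continuousOn (F := fε) (p := 𝓝[>] (0 : ℝ)) ?_
      (hev.mono fun ε hε => (hfε ε hε).continuousOn).frequently
    rw [EMetric.tendstoUniformlyOn_iff]
    intro δ hδ
    filter_upwards [hunif K hK δ hδ] with ε hε x hx
    rw [edist_comm]
    exact hε x hx
  have hatt : ∀ y : Υ, (⨅ x ∈ f ⁻¹' {y}, Λ x) < ⊤ →
      ∃ x, f x = y ∧ Λ x ≤ ⨅ x ∈ f ⁻¹' {y}, Λ x := by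
    intro y hy
    obtain ⟨β, hβ1, hβ2⟩ := ENNReal.lt_iff_exists_nnreal_btwn.1 hy
    obtain ⟨x0, hx0, hx0'⟩ : ∃ x, f x = y ∧ Λ x < β := by
      simpa [iInf_lt_iff] using hβ1
    have hc : IsCompact ({x : χ | Λ x ≤ β} ∩ f ⁻¹' {y}) :=
      (hΛgood β).inter_right (isClosed_singleton.preimage hfc)
    obtain ⟨x, hx, hmin⟩ := LowerSemicontinuousOn.exists_isMinOn
      (s := {x : χ | Λ x ≤ β} ∩ f ⁻¹' {y}) ⟨x0, hx0'.le, hx0⟩ hc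
      (hΛlsc.lowerSemicontinuousOn _)
    refine ⟨x, hx.2, le_iInf₂ fun z hz => ?_⟩
    rcases le_total (Λ z) β with h | h
    · exact hmin ⟨h, hz⟩
    · exact le_trans hx.1 h
  have hlevel : ∀ α : ℝ≥0, IsCompact {y : Υ | (⨅ x ∈ f ⁻¹' {y}, Λ x) ≤ α} := by
    intro α
    have : {y : Υ | (⨅ x ∈ f ⁻¹' {y}, Λ x) ≤ α} = f '' {x : χ | Λ x ≤ α} := by
      ext y
      constructor
      · intro hy
        obtain ⟨x, hx, hx'⟩ := hatt y (lt_of_le_of_lt hy ENNReal.coe_lt_top)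
        exact ⟨x, hx'.trans hy, hx⟩
      · rintro ⟨x, hx, rfl⟩
        exact le_trans (iInf₂_le (f := fun z (_ : z ∈ f ⁻¹' {f x}) => Λ z) x rfl) hx
    rw [this]
    exact (hΛgood α).image hfc
  refine ⟨?_, hlevel, ?_, ?_⟩
  · rw [lowerSemicontinuous_iff_isClosed_preimage]
    intro a
    induction a with
    | top => simp
    | coe a => exact (hlevel a).isClosed
  · intro F hF
    by_contra! hcon
    set L := Filter.limsup (fun ε : ℝ =>
      (ε : EReal) * ENNReal.log (⨆ P ∈ 𝔓 ε, P (fε ε ⁻¹' F))) (𝓝[>] (0 : ℝ)) with hL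
    have hL0 : L ≤ 0 := by
      refine le_trans ?_ ((hupper Set.univ isClosed_univ).trans ?_)
      · refine limsup_le_limsup ?_
        filter_upwards [self_mem_nhdsWithin] with ε hε
        have hε' : (0 : EReal) ≤ ε := by exact_mod_cast (le_of_lt hε)
        refine mul_le_mul_of_nonneg_left (ENNReal.log_le_log ?_) hε'
        exact iSup₂_mono fun P _ => measure_mono (Set.subset_univ _)
      · rw [EReal.neg_le, neg_zero]
        exact le_iInf₂ fun x _ => EReal.coe_ennreal_nonneg _
    obtain ⟨b0, h1, h2⟩ := EReal.lt_iff_exists_real_btwn.1 hcon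
    obtain ⟨b', h3, h4⟩ := EReal.lt_iff_exists_real_btwn.1 h2
    obtain ⟨b, h5, h6⟩ := EReal.lt_iff_exists_real_btwn.1 h3
    have hb0 : b0 < 0 := by exact_mod_cast h2.trans_le hL0
    have hbb : b < b' := by exact_mod_cast h6
    let a : ℝ≥0 := ⟨-b0, by linarith⟩
    have ha : ((a : ℝ≥0∞) : EReal) = ((-b0 : ℝ) : EReal) := rfl
    have hdis : Disjoint (f '' {x : χ | Λ x ≤ a}) F := by
      rw [Set.disjoint_left]
      rintro _ ⟨x, hx, rfl⟩ hxF
      have h7 : (⨅ y ∈ F, ((⨅ x ∈ f ⁻¹' {y}, Λ x : ℝ≥0∞) : EReal)) ≤ ((-b0 : ℝ) : EReal) := by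
        rw [← ha]
        exact (iInf₂_le (f x) hxF).trans
          (EReal.coe_ennreal_le_coe_ennreal_iff.2 (le_trans (iInf₂_le (f := fun z (_ : z ∈ f ⁻¹' {f x}) => Λ z) x rfl) hx))
      rw [EReal.neg_lt_comm] at h1
      exact absurd h1 (not_lt.2 (by simpa using h7))
    obtain ⟨δ, hδ, hdδ⟩ := hdis.exists_cthickenings ((hΛgood a).image hfc) hF
    have hG : IsClosed (f ⁻¹' Metric.cthickening δ F) := Metric.isClosed_cthickening.preimage hfc
    have hGl := (hupper _ hG).trans (b := _) (c := (b0 : EReal)) (by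
      rw [EReal.neg_le, ← EReal.coe_neg, ← ha]
      refine le_iInf₂ fun x hx => EReal.coe_ennreal_le_coe_ennreal_iff.2 ?_
      by_contra! hlt
      exact Set.disjoint_left.1 hdδ
        (Metric.self_subset_cthickening _ ⟨x, hlt.le, rfl⟩) hx)
    obtain ⟨K, hK, hKl⟩ := htight (-b0) (by linarith)
    rw [neg_neg] at hKl
    have hend : ∀ᶠ ε : ℝ in 𝓝[>] (0 : ℝ),
        (ε : EReal) * ENNReal.log (⨆ P ∈ 𝔓 ε, P (fε ε ⁻¹' F)) ≤ b' := by
      filter_upwards [aux_log_add b b' hbb, eventually_lt_of_limsup_lt (hGl.trans_lt h5),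
        eventually_lt_of_limsup_lt (hKl.trans_lt h5),
        hunif K hK (ENNReal.ofReal δ) (ENNReal.ofReal_pos.2 hδ)] with ε e1 e2 e3 e4
      refine (e1 _ _ _ (aux_sup_union _ ?_) e2 e3).le
      intro x hx
      by_cases hxK : x ∈ K
      · left
        refine Metric.mem_cthickening_of_edist_le (f x) (fε ε x) δ F hx ?_
        rw [edist_comm]
        exact (e4 x hxK).le
      · exact Or.inr hxK
    exact absurd (limsup_le_of_le (by isBoundedDefault) hend) (not_le.2 h4)
  · intro O hO
    by_contra! hcon
    set L := Filter.liminf (fun ε : ℝ =>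
      (ε : EReal) * ENNReal.log (⨆ P ∈ 𝔓 ε, P (fε ε ⁻¹' O))) (𝓝[>] (0 : ℝ)) with hL
    rw [EReal.lt_neg_comm] at hcon
    simp only [iInf_lt_iff] at hcon
    obtain ⟨y, hy, hcon⟩ := hcon
    have hlt : (⨅ x ∈ f ⁻¹' {y}, Λ x) < ⊤ := by
      by_contra! h
      rw [top_le_iff.1 h] at hcon
      exact absurd hcon (by simp)
    obtain ⟨x, rfl, hx⟩ := hatt y hlt
    have hxL : L < -(Λ x : EReal) := by
      rw [EReal.lt_neg_comm]
      exact lt_of_le_of_lt (EReal.coe_ennreal_le_coe_ennreal_iff.2 hx) hcon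
    have hxtop : Λ x < ⊤ := hx.trans_lt hlt
    obtain ⟨a, ha⟩ : ∃ a : ℝ≥0, (a : ℝ≥0∞) = Λ x := ⟨_, ENNReal.coe_toNNReal hxtop.ne⟩
    have hxa : -(Λ x : EReal) = ((-(a : ℝ) : ℝ) : EReal) := by rw [← ha]; rfl
    obtain ⟨K, hK, hKl⟩ := htight (a + 1) (by positivity)
    have hmax : max L ((-(a + 1 : ℝ) : ℝ) : EReal) < -(Λ x : EReal) := by
      refine max_lt hxL ?_
      rw [hxa]
      exact_mod_cast (by linarith : (-(a + 1 : ℝ)) < -(a : ℝ))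
    obtain ⟨b', h3, h4⟩ := EReal.lt_iff_exists_real_btwn.1 hmax
    obtain ⟨b, h5, h6⟩ := EReal.lt_iff_exists_real_btwn.1 h3
    have hbb : b < b' := by exact_mod_cast h6
    obtain ⟨h7, h8⟩ := max_lt_iff.1 h5
    obtain ⟨r, hr, hrO⟩ := EMetric.isOpen_iff.1 hO (f x) hy
    have hr2 : 0 < r / 2 := ENNReal.half_pos hr.ne'
    have hU : IsOpen (f ⁻¹' Metric.eball (f x) (r / 2)) := Metric.isOpen_eball.preimage hfc
    have hUl : (b' : EReal) < _ := lt_of_lt_of_le (h4.trans_le (by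
      rw [EReal.neg_le_neg_iff]
      exact iInf₂_le (f := fun z (_ : z ∈ f ⁻¹' Metric.eball (f x) (r / 2)) => (Λ z : EReal)) x
        (Metric.mem_eball_self hr2))) (hlower _ hU)
    have hfr := frequently_lt_of_liminf_lt (by isBoundedDefault) h7
    obtain ⟨ε, e0, e1, e2, e3, e4⟩ := (hfr.and_eventually ((aux_log_add b b' hbb).and
      ((eventually_lt_of_lt_liminf hUl).and ((eventually_lt_of_limsup_lt (hKl.trans_lt h8)).and
        (hunif K hK (r / 2) hr2))))).exists
    refine lt_asymm e2 (e1 _ _ _ (aux_sup_union _ ?_) e0 e3)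
    intro z hz
    by_cases hzK : z ∈ K
    · left
      refine hrO ?_
      rw [Metric.mem_eball]
      calc edist (fε ε z) (f x) ≤ edist (fε ε z) (f z) + edist (f z) (f x) := edist_triangle _ _ _
        _ < r / 2 + r / 2 := ENNReal.add_lt_add (e4 z hzK) hz
        _ = r := ENNReal.add_halves r
    · exact Or.inr hzK
end

section
/- The subdifferential of a proper lower semicontinuous convex function on ℝ is a maximal monotone operator: (i) monotonicity: for all y, y', u, u' ∈ ℝ with u ∈ ∂Π(y) and u' ∈ ∂Π(y'), one has (y − y')(u − u') ≥ 0; (ii) maximality: if y₀, u₀ ∈ ℝ are such that (y − y₀)(u − u₀) ≥ 0 for every pair (y, u) with u ∈ ∂Π(y), then u₀ ∈ ∂Π(y₀). -/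
/-- Affine-type minorant for an lsc convex function. -/
theorem aux_minorant (Φ : ℝ → EReal)
    (hbot : ∀ y : ℝ, Φ y ≠ ⊥)
    (hconv : ∀ y z θ : ℝ, 0 ≤ θ → θ ≤ 1 →
      Φ (θ * y + (1 - θ) * z) ≤ (θ : EReal) * Φ y + ((1 - θ : ℝ) : EReal) * Φ z)
    (hlsc : LowerSemicontinuous Φ) (a c : ℝ) (ha : Φ a = c) :
    ∃ K : ℝ, 0 ≤ K ∧ ∀ v r : ℝ, Φ v = r → c - 1 - K * |v - a| ≤ r := by
  have h1 : ((c - 1 : ℝ) : EReal) < Φ a := by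
    rw [ha]; exact_mod_cast sub_one_lt c
  have h2 : ∀ᶠ y in nhds a, ((c - 1 : ℝ) : EReal) < Φ y := hlsc a _ h1
  obtain ⟨ε, hε, hball⟩ := Metric.eventually_nhds_iff.1 h2
  set δ := ε / 2 with hδ
  have hδ0 : 0 < δ := by positivity
  have hK : 0 ≤ 1 / δ := by positivity
  refine ⟨1 / δ, hK, fun v r hv => ?_⟩
  have hs0 : 0 ≤ |v - a| := abs_nonneg _
  by_cases hs : |v - a| ≤ δ
  · have := hball (y := v) (by rw [Real.dist_eq]; linarith)
    rw [hv] at this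
    have h3 : c - 1 < r := by exact_mod_cast this
    have : 0 ≤ 1 / δ * |v - a| := by positivity
    linarith
  · push Not at hs
    have hspos : 0 < |v - a| := by linarith
    set θ := δ / |v - a| with hθ
    have hθ0 : 0 < θ := by positivity
    have hθ1 : θ ≤ 1 := by rw [hθ, div_le_one hspos]; exact hs.le
    have hw := hball (y := θ * v + (1 - θ) * a) (by
      rw [Real.dist_eq, show θ * v + (1 - θ) * a - a = θ * (v - a) by ring, abs_mul,
        abs_of_pos hθ0, hθ, div_mul_cancel₀ _ hspos.ne']
      linarith)
    have h4 := lt_of_lt_of_le hw (hconv v a θ hθ0.le hθ1)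
    rw [hv, ha] at h4
    have h5 : c - 1 < θ * r + (1 - θ) * c := by exact_mod_cast h4
    have h6 : θ * (c - 1 / δ * |v - a|) = θ * c - 1 := by
      rw [mul_sub, hθ]; field_simp
    have h7 : θ * (c - 1 / δ * |v - a|) < θ * r := by rw [h6]; linarith
    have := lt_of_mul_lt_mul_left h7 hθ0.le
    linarith

/-- Surjectivity of `id + ∂Φ`. -/
theorem aux_minty (Φ : ℝ → EReal)
    (hbot : ∀ y : ℝ, Φ y ≠ ⊥)
    (hproper : ∃ y : ℝ, Φ y ≠ ⊤)
    (hconv : ∀ y z θ : ℝ, 0 ≤ θ → θ ≤ 1 →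
      Φ (θ * y + (1 - θ) * z) ≤ (θ : EReal) * Φ y + ((1 - θ : ℝ) : EReal) * Φ z)
    (hlsc : LowerSemicontinuous Φ) (x : ℝ) :
    ∃ p : ℝ, ∀ v : ℝ, (((x - p) * (v - p) : ℝ) : EReal) + Φ p ≤ Φ v := by
  obtain ⟨a, hat⟩ := hproper
  obtain ⟨c, ha⟩ : ∃ c : ℝ, Φ a = c := ⟨_, (EReal.coe_toReal hat (hbot a)).symm⟩
  obtain ⟨K, hK, hmin⟩ := aux_minorant Φ hbot hconv hlsc a c ha
  set q : ℝ → EReal := fun y => (((y - x) ^ 2 / 2 : ℝ) : EReal) with hq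
  have hqc : Continuous q := continuous_coe_real_ereal.comp (by fun_prop)
  have hg : LowerSemicontinuous (fun y => Φ y + q y) := by
    refine hlsc.add' hqc.lowerSemicontinuous fun y => ?_
    exact EReal.continuousAt_add (Or.inr (EReal.coe_ne_bot _)) (Or.inr (EReal.coe_ne_top _))
  set R := 2 * (|a - x| + K) + 2 with hR
  have hR2 : 2 ≤ R := by have := abs_nonneg (a - x); linarith
  obtain ⟨p, hpm, hp⟩ := (hg.lowerSemicontinuousOn (Set.Icc (a - R) (a + R))).exists_isMinOn
    ⟨a, by constructor <;> linarith⟩ isCompact_Icc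
  have hpa : Φ p + q p ≤ Φ a + q a := hp ⟨by linarith, by linarith⟩
  have hglob : ∀ v, Φ p + q p ≤ Φ v + q v := by
    intro v
    by_cases hv : v ∈ Set.Icc (a - R) (a + R)
    · exact hp hv
    refine hpa.trans ?_
    by_cases hvt : Φ v = ⊤
    · rw [hvt, hq, EReal.top_add_coe]; exact le_top
    obtain ⟨r, hr⟩ : ∃ r : ℝ, Φ v = r := ⟨_, (EReal.coe_toReal hvt (hbot v)).symm⟩
    have h1 := hmin v r hr
    have hsR : R ≤ |v - a| := by
      by_contra h
      push Not at h
      have := abs_lt.1 h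
      exact hv ⟨by linarith, by linarith⟩
    rw [ha, hr]
    have key : c + (a - x) ^ 2 / 2 ≤ r + (v - x) ^ 2 / 2 := by
      have e1 : (v - x) ^ 2 = |v - a| ^ 2 + 2 * ((v - a) * (a - x)) + (a - x) ^ 2 := by
        rw [sq_abs]; ring
      have e2 : -(|v - a| * |a - x|) ≤ (v - a) * (a - x) := by
        rw [← abs_mul]; exact neg_abs_le _
      have e3 : 0 ≤ |v - a| * (|v - a| - R) :=
        mul_nonneg (abs_nonneg _) (by linarith)
      rw [hR] at e3
      nlinarith
    simp only [hq]
    exact_mod_cast key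
  have hpt : Φ p ≠ ⊤ := by
    intro h
    rw [h, ha, hq, EReal.top_add_coe] at hpa
    have : ((c + (a - x) ^ 2 / 2 : ℝ) : EReal) = ⊤ := top_le_iff.1 (by exact_mod_cast hpa)
    exact EReal.coe_ne_top _ this
  obtain ⟨b, hb⟩ : ∃ b : ℝ, Φ p = b := ⟨_, (EReal.coe_toReal hpt (hbot p)).symm⟩
  refine ⟨p, fun v => ?_⟩
  by_cases hvt : Φ v = ⊤
  · rw [hvt]; exact le_top
  obtain ⟨r, hr⟩ : ∃ r : ℝ, Φ v = r := ⟨_, (EReal.coe_toReal hvt (hbot v)).symm⟩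
  have main : ∀ t : ℝ, 0 < t → t ≤ 1 → b ≤ r + (v - p) * (p - x) + t * (v - p) ^ 2 / 2 := by
    intro t ht0 ht1
    have h1 := (hglob (t * v + (1 - t) * p)).trans
      (add_le_add_left (hconv v p t ht0.le ht1) _)
    rw [hb, hr] at h1
    simp only [hq] at h1
    have h2 : b + (p - x) ^ 2 / 2 ≤ t * r + (1 - t) * b + (t * v + (1 - t) * p - x) ^ 2 / 2 := by
      exact_mod_cast h1
    have h3 : t * b ≤ t * (r + (v - p) * (p - x) + t * (v - p) ^ 2 / 2) := by
      linarith
    exact le_of_mul_le_mul_left h3 ht0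
  rw [hb, hr]
  have fin : (x - p) * (v - p) + b ≤ r := by
    by_contra h
    push Not at h
    set d := (x - p) * (v - p) + b - r with hd
    have hd0 : 0 < d := by linarith
    have hD : 0 < (v - p) ^ 2 + d := by positivity
    have := main (d / ((v - p) ^ 2 + d)) (by positivity)
      (by rw [div_le_one hD]; linarith [sq_nonneg (v - p)])
    have h5 : d / ((v - p) ^ 2 + d) * (v - p) ^ 2 ≤ d := by
      rw [div_mul_eq_mul_div, div_le_iff₀ hD]
      nlinarith [sq_nonneg (v - p)]
    linarith
  exact_mod_cast fin

/-- **The subdifferential of a proper l.s.c. convex function on `ℝ` is maximal monotone.**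
Here `Φ : ℝ → EReal` never takes the value `⊥` (so it maps into `ℝ ∪ {+∞}`), is proper,
convex and lower semicontinuous.  The subdifferential condition `u ∈ ∂Φ(y)` is expressed as
`∀ v, u * (v - y) + Φ y ≤ Φ v`.  Conclusion: (i) the subdifferential is monotone, and
(ii) it is maximal: any pair `(y₀, u₀)` that is monotonically related to every pair of the
graph belongs to the graph. -/
theorem subdifferential_maximal_monotone
    (Φ : ℝ → EReal)
    (hbot : ∀ y : ℝ, Φ y ≠ ⊥)
    (hproper : ∃ y : ℝ, Φ y ≠ ⊤)
    (hconv : ∀ y z θ : ℝ, 0 ≤ θ → θ ≤ 1 →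
      Φ (θ * y + (1 - θ) * z) ≤ (θ : EReal) * Φ y + ((1 - θ : ℝ) : EReal) * Φ z)
    (hlsc : LowerSemicontinuous Φ) :
    (∀ y y' u u' : ℝ,
        (∀ v : ℝ, ((u * (v - y) : ℝ) : EReal) + Φ y ≤ Φ v) →
        (∀ v : ℝ, ((u' * (v - y') : ℝ) : EReal) + Φ y' ≤ Φ v) →
        0 ≤ (y - y') * (u - u')) ∧
    (∀ y₀ u₀ : ℝ,
        (∀ y u : ℝ,
          (∀ v : ℝ, ((u * (v - y) : ℝ) : EReal) + Φ y ≤ Φ v) →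
          0 ≤ (y - y₀) * (u - u₀)) →
        ∀ v : ℝ, ((u₀ * (v - y₀) : ℝ) : EReal) + Φ y₀ ≤ Φ v) := by
  constructor
  · intro y y' u u' h h'
    obtain ⟨a, hat⟩ := hproper
    have hfin : ∀ y u : ℝ, (∀ v : ℝ, ((u * (v - y) : ℝ) : EReal) + Φ y ≤ Φ v) →
        ∃ b : ℝ, Φ y = b := by
      intro y u h
      refine ⟨_, (EReal.coe_toReal (fun ht => hat ?_) (hbot y)).symm⟩
      have := h a
      rw [ht, EReal.coe_add_top] at this
      exact top_le_iff.1 this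
    obtain ⟨b, hb⟩ := hfin y u h
    obtain ⟨b', hb'⟩ := hfin y' u' h'
    have h1 := h y'
    have h2 := h' y
    rw [hb, hb'] at h1 h2
    have h3 : u * (y' - y) + b ≤ b' := by exact_mod_cast h1
    have h4 : u' * (y - y') + b' ≤ b := by exact_mod_cast h2
    nlinarith
  · intro y₀ u₀ h
    obtain ⟨p, hp⟩ := aux_minty Φ hbot hproper hconv hlsc (y₀ + u₀)
    have h1 := h p (y₀ + u₀ - p) hp
    have h2 : (p - y₀) ^ 2 = 0 := le_antisymm (by nlinarith) (sq_nonneg _)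
    have h3 : p = y₀ := by
      have := pow_eq_zero_iff (two_ne_zero) |>.1 h2
      linarith
    subst h3
    simpa using hp
end

section
/- Uniqueness for the deterministic backward variational inequality: Let s < T be real numbers, ξ ∈ ℝ, let Π : ℝ → ℝ ∪ {+∞} be proper, convex and lower semicontinuous, and let F : [s,T] × ℝ → ℝ be such that t ↦ F(t, y) is measurable for each y, t ↦ F(t, 0) is integrable on [s,T], and there is L > 0 with |F(t,y) − F(t,y')| ≤ L|y − y'| for all t ∈ [s,T] and y, y' ∈ ℝ. Suppose (ψ, U) and (ψ̃, Ũ) are two pairs with ψ, ψ̃ : [s,T] → ℝ continuous and U, Ũ ∈ L¹(s,T), satisfying for every t ∈ [s,T]: ψ(t) = ξ + ∫_t^T F(r, ψ(r)) dr − ∫_t^T U(r) dr with U(r) ∈ ∂Π(ψ(r)) for almost every r ∈ [s,T], and likewise ψ̃(t) = ξ + ∫_t^T F(r, ψ̃(r)) dr − ∫_t^T Ũ(r) dr with Ũ(r) ∈ ∂Π(ψ̃(r)) for almost every r ∈ [s,T]. Then ψ(t) = ψ̃(t) for all t ∈ [s,T], and U(r) = Ũ(r) for almost every r ∈ [s,T].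 -/
open MeasureTheory intervalIntegral

lemma bvi_comp_integrable (s T : ℝ) (hsT : s < T) (F : ℝ → ℝ → ℝ)
    (hFmeas : ∀ y : ℝ, Measurable (fun t => F t y))
    (hFint : IntegrableOn (fun t => F t 0) (Set.Icc s T))
    (L : ℝ)
    (hFlip : ∀ t ∈ Set.Icc s T, ∀ y y' : ℝ, |F t y - F t y'| ≤ L * |y - y'|)
    (ψ : ℝ → ℝ) (hψc : ContinuousOn ψ (Set.Icc s T)) :
    IntegrableOn (fun t => F t (ψ t)) (Set.Icc s T) := by
  have hLn : 0 ≤ L := by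
    have h := hFlip s ⟨le_rfl, hsT.le⟩ 1 0
    have := (abs_nonneg _).trans h
    simpa using this
  let p : ℝ → ℝ := fun t => (Set.projIcc s T hsT.le t : ℝ)
  have hpc : Continuous p := continuous_subtype_val.comp continuous_projIcc
  have hpm : ∀ t, p t ∈ Set.Icc s T := fun t => (Set.projIcc s T hsT.le t).2
  have hpe : ∀ t ∈ Set.Icc s T, p t = t := fun t ht => by
    simp only [p, Set.projIcc_of_mem hsT.le ht]
  have hu : Measurable (Function.uncurry (fun y t => F (p t) y)) := by
    apply measurable_uncurry_of_continuous_of_measurable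
    · intro t
      refine (LipschitzWith.of_dist_le_mul (K := L.toNNReal) ?_).continuous
      intro y y'
      simpa [Real.dist_eq, hLn] using hFlip (p t) (hpm t) y y'
    · intro y
      exact (hFmeas y).comp hpc.measurable
  have hψp : Continuous (fun t => ψ (p t)) := hψc.comp_continuous hpc hpm
  have hm : Measurable (fun t => F (p t) (ψ (p t))) :=
    hu.comp (hψp.measurable.prodMk measurable_id)
  have hg : IntegrableOn (fun t => ‖F t 0‖ + L * ‖ψ t‖) (Set.Icc s T) :=
    hFint.norm.add ((hψc.norm.integrableOn_Icc).const_mul L)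
  have h1 : IntegrableOn (fun t => F (p t) (ψ (p t))) (Set.Icc s T) := by
    refine Integrable.mono' hg hm.aestronglyMeasurable ?_
    refine (ae_restrict_iff' measurableSet_Icc).2 (Filter.Eventually.of_forall fun t ht => ?_)
    rw [hpe t ht]
    have h := hFlip t ht (ψ t) 0
    simp only [Real.norm_eq_abs]
    rw [sub_zero] at h
    have := abs_sub_abs_le_abs_sub (F t (ψ t)) (F t 0)
    linarith
  refine h1.congr_fun (fun t ht => ?_) measurableSet_Icc
  simp only [hpe t ht]

/-- Monotonicity of the subdifferential. -/
lemma bvi_mono (Φ : ℝ → EReal) (hbot : ∀ y : ℝ, Φ y ≠ ⊥) (hproper : ∃ y : ℝ, Φ y ≠ ⊤)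
    (a b u w : ℝ)
    (hu : ∀ v : ℝ, ((u * (v - a) : ℝ) : EReal) + Φ a ≤ Φ v)
    (hw : ∀ v : ℝ, ((w * (v - b) : ℝ) : EReal) + Φ b ≤ Φ v) :
    0 ≤ (a - b) * (u - w) := by
  obtain ⟨y, hy⟩ := hproper
  have ha : Φ a ≠ ⊤ := by
    intro h
    have := hu y
    rw [h, EReal.coe_add_top] at this
    exact hy (top_le_iff.1 this)
  have hb : Φ b ≠ ⊤ := by
    intro h
    have := hw y
    rw [h, EReal.coe_add_top] at this
    exact hy (top_le_iff.1 this)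
  have h1 := hu b
  have h2 := hw a
  rw [← EReal.coe_toReal ha (hbot a), ← EReal.coe_toReal hb (hbot b)] at h1 h2
  norm_cast at h1 h2
  nlinarith

/-- **Uniqueness for the deterministic backward variational inequality.** Let `s < T`,
`ξ ∈ ℝ`, let `Φ : ℝ → EReal` be proper, convex and lower semicontinuous (never `⊥`, so it
maps into `ℝ ∪ {+∞}`), and let `F : [s,T] × ℝ → ℝ` be measurable in time, integrable at
`y = 0`, and Lipschitz in `y` with constant `L`.  If `(ψ, U)` and `(ψ̃, Ũ)` both solve the
backward equation `ψ t = ξ + ∫_t^T F r (ψ r) dr − ∫_t^T U r dr` on `[s,T]` with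
`U r ∈ ∂Φ (ψ r)` a.e., then `ψ = ψ̃` on `[s,T]` and `U = Ũ` a.e. on `[s,T]`. -/
theorem backward_variational_inequality_uniqueness
    (s T ξ : ℝ) (hsT : s < T)
    (Φ : ℝ → EReal)
    (hbot : ∀ y : ℝ, Φ y ≠ ⊥)
    (hproper : ∃ y : ℝ, Φ y ≠ ⊤)
    (hconv : ∀ y z θ : ℝ, 0 ≤ θ → θ ≤ 1 →
      Φ (θ * y + (1 - θ) * z) ≤ (θ : EReal) * Φ y + ((1 - θ : ℝ) : EReal) * Φ z)
    (hlsc : LowerSemicontinuous Φ)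
    (F : ℝ → ℝ → ℝ)
    (hFmeas : ∀ y : ℝ, Measurable (fun t => F t y))
    (hFint : IntegrableOn (fun t => F t 0) (Set.Icc s T))
    (L : ℝ) (hL : 0 < L)
    (hFlip : ∀ t ∈ Set.Icc s T, ∀ y y' : ℝ, |F t y - F t y'| ≤ L * |y - y'|)
    (ψ ψt : ℝ → ℝ) (U Ut : ℝ → ℝ)
    (hψc : ContinuousOn ψ (Set.Icc s T))
    (hψtc : ContinuousOn ψt (Set.Icc s T))
    (hUint : IntegrableOn U (Set.Icc s T))
    (hUtint : IntegrableOn Ut (Set.Icc s T))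
    (hψeq : ∀ t ∈ Set.Icc s T,
      ψ t = ξ + (∫ r in t..T, F r (ψ r)) - ∫ r in t..T, U r)
    (hUsub : ∀ᵐ r ∂(volume.restrict (Set.Icc s T)),
      ∀ v : ℝ, ((U r * (v - ψ r) : ℝ) : EReal) + Φ (ψ r) ≤ Φ v)
    (hψteq : ∀ t ∈ Set.Icc s T,
      ψt t = ξ + (∫ r in t..T, F r (ψt r)) - ∫ r in t..T, Ut r)
    (hUtsub : ∀ᵐ r ∂(volume.restrict (Set.Icc s T)),
      ∀ v : ℝ, ((Ut r * (v - ψt r) : ℝ) : EReal) + Φ (ψt r) ≤ Φ v) :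
    (∀ t ∈ Set.Icc s T, ψ t = ψt t) ∧
    (∀ᵐ r ∂(volume.restrict (Set.Icc s T)), U r = Ut r) := by
  have hF1 := bvi_comp_integrable s T hsT F hFmeas hFint L hFlip ψ hψc
  have hF2 := bvi_comp_integrable s T hsT F hFmeas hFint L hFlip ψt hψtc
  have hsub : ∀ t ∈ Set.Icc s T, Set.uIoc t T ⊆ Set.Icc s T := by
    intro t ht
    rw [Set.uIoc_of_le ht.2]
    exact fun x hx => ⟨ht.1.trans hx.1.le, hx.2⟩
  have hii : ∀ f : ℝ → ℝ, IntegrableOn f (Set.Icc s T) → ∀ t ∈ Set.Icc s T,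
      IntervalIntegrable f volume t T := fun f hf t ht =>
    intervalIntegrable_iff.2 (hf.mono_set (hsub t ht))
  have hs : s ∈ Set.Icc s T := ⟨le_rfl, hsT.le⟩
  have huI : Set.uIcc s T = Set.Icc s T := Set.uIcc_of_le hsT.le
  let g : ℝ → ℝ := fun r => (F r (ψ r) - F r (ψt r)) - (U r - Ut r)
  have hg : IntegrableOn g (Set.Icc s T) := (hF1.sub hF2).sub (hUint.sub hUtint)
  have hgi := hii g hg s hs
  let G : ℝ → ℝ := fun x => ∫ r in T..x, g r
  have hGD : ∀ t ∈ Set.Icc s T, G t = ψt t - ψ t := by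
    intro t ht
    have e1 := hii _ hF1 t ht
    have e2 := hii _ hF2 t ht
    have e3 := hii _ hUint t ht
    have e4 := hii _ hUtint t ht
    have : ∫ r in t..T, g r = ((∫ r in t..T, F r (ψ r)) - ∫ r in t..T, F r (ψt r))
        - ((∫ r in t..T, U r) - ∫ r in t..T, Ut r) := by
      rw [← intervalIntegral.integral_sub e1 e2, ← intervalIntegral.integral_sub e3 e4,
        ← intervalIntegral.integral_sub (e1.sub e2) (e3.sub e4)]
    simp only [G]
    rw [intervalIntegral.integral_symm, this, hψeq t ht, hψteq t ht]
    ring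
  have hGac : AbsolutelyContinuousOnInterval G s T :=
    hgi.absolutelyContinuousOnInterval_intervalIntegral (by simp)
  have hGd : ∀ᵐ x, x ∈ Set.Icc s T → HasDerivAt G (g x) x := by
    filter_upwards [hgi.ae_hasDerivAt_integral] with x hx hxI
    exact hx (by rwa [huI]) T (by simp)
  have hEac : AbsolutelyContinuousOnInterval (fun x => Real.exp (2 * L * x)) s T := by
    apply ContDiffOn.absolutelyContinuousOnInterval
    apply ContDiff.contDiffOn
    fun_prop
  let h : ℝ → ℝ := fun x => Real.exp (2 * L * x) * (G x * G x)
  have hhac : AbsolutelyContinuousOnInterval h s T := hEac.fun_mul (hGac.fun_mul hGac)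
  have hderiv : ∀ᵐ x, x ∈ Set.Icc s T → 0 ≤ deriv h x := by
    filter_upwards [hGd, (ae_restrict_iff' measurableSet_Icc).1 hUsub,
      (ae_restrict_iff' measurableSet_Icc).1 hUtsub] with x hx h1 h2 hxI
    have hm := bvi_mono Φ hbot hproper (ψ x) (ψt x) (U x) (Ut x) (h1 hxI) (h2 hxI)
    have hl := hFlip x hxI (ψ x) (ψt x)
    have hd1 : HasDerivAt (fun x => Real.exp (2 * L * x))
        (Real.exp (2 * L * x) * (2 * L)) x := by
      simpa using ((hasDerivAt_id x).const_mul (2 * L)).exp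
    have hd := hd1.mul ((hx hxI).mul (hx hxI))
    have hd' : deriv h x = _ := hd.deriv
    rw [hd']
    have key : 0 ≤ L * (G x * G x) + G x * g x := by
      rw [hGD x hxI]
      simp only [g]
      have habs : (ψ x - ψt x) * (F x (ψ x) - F x (ψt x)) ≤ L * ((ψ x - ψt x) * (ψ x - ψt x)) := by
        calc _ ≤ |(ψ x - ψt x) * (F x (ψ x) - F x (ψt x))| := le_abs_self _
          _ = |ψ x - ψt x| * |F x (ψ x) - F x (ψt x)| := abs_mul _ _
          _ ≤ |ψ x - ψt x| * (L * |ψ x - ψt x|) := by gcongr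
          _ = L * (|ψ x - ψt x| * |ψ x - ψt x|) := by ring
          _ = _ := by rw [abs_mul_abs_self]
      nlinarith
    have := mul_nonneg (Real.exp_pos (2 * L * x)).le key
    simp only [Pi.mul_apply]
    nlinarith
  have hG0 : ∀ t ∈ Set.Icc s T, G t = 0 := by
    intro t ht
    have hac : AbsolutelyContinuousOnInterval h t T := hhac.mono (by
      rw [huI, Set.uIcc_of_le ht.2]
      exact Set.Icc_subset_Icc_left ht.1)
    have hi := hac.integral_deriv_eq_sub
    have hn : 0 ≤ ∫ x in t..T, deriv h x := by
      apply intervalIntegral.integral_nonneg_of_ae_restrict ht.2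
      refine (ae_restrict_iff' measurableSet_Icc).2 ?_
      filter_upwards [hderiv] with x hx hxI
      exact hx ⟨ht.1.trans hxI.1, hxI.2⟩
    have hT : h T = 0 := by simp [h, G]
    rw [hi, hT] at hn
    have : Real.exp (2 * L * t) * (G t * G t) ≤ 0 := by
      have : h t ≤ 0 := by linarith
      exact this
    have h3 : G t * G t ≤ 0 := nonpos_of_mul_nonpos_right this (Real.exp_pos _)
    exact mul_self_eq_zero.1 (le_antisymm h3 (mul_self_nonneg _))
  have hψ : ∀ t ∈ Set.Icc s T, ψ t = ψt t := by
    intro t ht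
    have := hGD t ht
    rw [hG0 t ht] at this
    linarith
  refine ⟨hψ, (ae_restrict_iff' measurableSet_Icc).2 ?_⟩
  have hs1 : ∀ᵐ x : ℝ, x ≠ s := by simp [ae_iff, measure_singleton]
  have hT1 : ∀ᵐ x : ℝ, x ≠ T := by simp [ae_iff, measure_singleton]
  filter_upwards [hGd, hs1, hT1] with x hx hxs hxT hxI
  have hev : G =ᶠ[nhds x] fun _ => 0 := by
    filter_upwards [Icc_mem_nhds (lt_of_le_of_ne hxI.1 hxs.symm) (lt_of_le_of_ne hxI.2 hxT)]
      with y hy using hG0 y hy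
  have h0 : HasDerivAt G 0 x := (hasDerivAt_const x (0 : ℝ)).congr_of_eventuallyEq hev
  have he := (hx hxI).unique h0
  simp only [g] at he
  rw [hψ x hxI] at he
  linarith
end
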